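/- arXiv:2305.00660 — 3 statements merged into one kernel-verified Lean document; each statement's English description precedes it below -/
import Mathlib

section
/- For all vectors a, b ∈ ℝ^n with ‖a - b‖_∞ ≤ 0.01, one has ‖exp(a) - exp(b)‖_2 ≤ 2 · ‖exp(a)‖_2 · ‖a - b‖_∞. -/
/-- The Euclidean (ℓ2) norm of a vector in `ℝ^n`. -/
noncomputable def norm2 {n : ℕ} (v : Fin n → ℝ) : ℝ :=
  Real.sqrt (∑ i, v i ^ 2)

theorem abs_exp_sub_exp_le {x y : ℝ} (h : |x - y| ≤ 1) :
    |Real.exp x - Real.exp y| ≤ 2 * |x - y| * Real.exp x := by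
  rw [abs_sub_comm] at h ⊢
  have hfactor : Real.exp y - Real.exp x = (Real.exp (y - x) - 1) * Real.exp x := by
    rw [sub_mul, ← Real.exp_add, sub_add_cancel, one_mul]
  rw [hfactor, abs_mul, Real.abs_exp, abs_sub_comm x y]
  gcongr
  exact Real.abs_exp_sub_one_le h

theorem norm2_le_mul_norm2 {n : ℕ} {u v : Fin n → ℝ} {c : ℝ} (hc : 0 ≤ c)
    (h : ∀ i, |u i| ≤ c * v i) : norm2 u ≤ c * norm2 v := by
  unfold norm2
  rw [Real.sqrt_le_left (by positivity), mul_pow, Real.sq_sqrt (by positivity), Finset.mul_sum]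
  refine Finset.sum_le_sum fun i _ => ?_
  rw [← mul_pow, ← sq_abs (u i)]
  gcongr
  exact h i

/-- For all vectors `a, b ∈ ℝ^n` with `‖a - b‖_∞ ≤ 0.01`, one has
`‖exp(a) - exp(b)‖_2 ≤ 2 · ‖exp(a)‖_2 · ‖a - b‖_∞`.
Here `‖·‖` on `Fin n → ℝ` is the sup (ℓ∞) norm. -/
theorem l2_exp_diff_le (n : ℕ) (a b : Fin n → ℝ) (h : ‖a - b‖ ≤ 0.01) :
    norm2 (fun i => Real.exp (a i) - Real.exp (b i))
      ≤ 2 * norm2 (fun i => Real.exp (a i)) * ‖a - b‖ := by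
  rw [mul_right_comm]
  refine norm2_le_mul_norm2 (by positivity) fun i => ?_
  have hi : |a i - b i| ≤ ‖a - b‖ := norm_le_pi_norm (a - b) i
  refine (abs_exp_sub_exp_le (hi.trans (h.trans (by norm_num)))).trans ?_
  gcongr
end

section
/- Let A ∈ ℝ^{n×d}, b ∈ ℝ^n, and define u(x) = exp(Ax) ∈ ℝ^n (entrywise exponential), α(x) = ⟨u(x), 1_n⟩, c(x) = u(x) - α(x)·b, and L_u(x) = 0.5·‖c(x)‖_2². Then for each i ∈ [d], the partial derivative of L_u with respect to the i-th coordinate x_i equals A_{*,i}^⊤ ( c(x) ∘ u(x) - u(x) · ⟨b, c(x)⟩ ), where A_{*,i} ∈ ℝ^n is the i-th column of A and ∘ denotes the entrywise product. -/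
/-- `u(x) = exp(Ax)` applied entrywise. -/
noncomputable def uexp {n d : ℕ} (A : Matrix (Fin n) (Fin d) ℝ) (x : Fin d → ℝ) : Fin n → ℝ :=
  fun j => Real.exp (A.mulVec x j)

/-- `α(x) = ⟨u(x), 1_n⟩`. -/
noncomputable def alph {n d : ℕ} (A : Matrix (Fin n) (Fin d) ℝ) (x : Fin d → ℝ) : ℝ :=
  ∑ j, uexp A x j

/-- `c(x) = u(x) - α(x)·b`. -/
noncomputable def cfun {n d : ℕ} (A : Matrix (Fin n) (Fin d) ℝ) (b : Fin n → ℝ)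
    (x : Fin d → ℝ) : Fin n → ℝ :=
  uexp A x - alph A x • b

/-- `L_u(x) = 0.5·‖c(x)‖_2²`. -/
noncomputable def Lu {n d : ℕ} (A : Matrix (Fin n) (Fin d) ℝ) (b : Fin n → ℝ)
    (x : Fin d → ℝ) : ℝ :=
  0.5 * ∑ j, cfun A b x j ^ 2

/-- The `j`-th entry of `A x`, as a continuous linear functional of `x`. -/
noncomputable def mulVecEntry {n d : ℕ} (A : Matrix (Fin n) (Fin d) ℝ) (j : Fin n) :
    (Fin d → ℝ) →L[ℝ] ℝ :=
  LinearMap.toContinuousLinearMap (LinearMap.proj j ∘ₗ A.mulVecLin)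

theorem mulVecEntry_apply {n d : ℕ} (A : Matrix (Fin n) (Fin d) ℝ) (j : Fin n) (x : Fin d → ℝ) :
    mulVecEntry A j x = A.mulVec x j := rfl

theorem hasFDerivAt_uexp {n d : ℕ} (A : Matrix (Fin n) (Fin d) ℝ) (x : Fin d → ℝ) (j : Fin n) :
    HasFDerivAt (fun y => uexp A y j) (uexp A x j • mulVecEntry A j) x :=
  (mulVecEntry A j).hasFDerivAt.exp

theorem hasFDerivAt_alph {n d : ℕ} (A : Matrix (Fin n) (Fin d) ℝ) (x : Fin d → ℝ) :
    HasFDerivAt (alph A) (∑ j, uexp A x j • mulVecEntry A j) x :=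
  HasFDerivAt.fun_sum fun j _ => hasFDerivAt_uexp A x j

theorem hasFDerivAt_cfun {n d : ℕ} (A : Matrix (Fin n) (Fin d) ℝ) (b : Fin n → ℝ)
    (x : Fin d → ℝ) (j : Fin n) :
    HasFDerivAt (fun y => cfun A b y j)
      (uexp A x j • mulVecEntry A j - b j • ∑ k, uexp A x k • mulVecEntry A k) x :=
  (hasFDerivAt_uexp A x j).sub ((hasFDerivAt_alph A x).mul_const (b j))

theorem hasFDerivAt_Lu {n d : ℕ} (A : Matrix (Fin n) (Fin d) ℝ) (b : Fin n → ℝ)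
    (x : Fin d → ℝ) :
    HasFDerivAt (Lu A b)
      (∑ j, cfun A b x j •
        (uexp A x j • mulVecEntry A j - b j • ∑ k, uexp A x k • mulVecEntry A k)) x := by
  have h := (HasFDerivAt.fun_sum (u := Finset.univ)
    fun j _ => (hasFDerivAt_cfun A b x j).pow 2).const_mul (0.5 : ℝ)
  refine h.congr_fderiv ?_
  rw [Finset.smul_sum]
  refine Finset.sum_congr rfl fun j _ => ?_
  rw [smul_smul]
  congr 1
  norm_num
  ring

/-- The partial derivative of `L_u` with respect to `x_i` equals
`A_{*,i}^⊤ (c(x) ∘ u(x) - u(x) · ⟨b, c(x)⟩)`. -/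
theorem partial_Lu (n d : ℕ) (A : Matrix (Fin n) (Fin d) ℝ) (b : Fin n → ℝ)
    (x : Fin d → ℝ) (i : Fin d) :
    fderiv ℝ (Lu A b) x (Pi.single i 1)
      = ∑ j, A j i * (cfun A b x j * uexp A x j - uexp A x j * (∑ k, b k * cfun A b x k)) := by
  rw [(hasFDerivAt_Lu A b x).fderiv]
  simp only [sum_apply, smul_apply,
    sub_apply, smul_eq_mul, mulVecEntry_apply,
    Matrix.mulVec_single_one, Matrix.col_apply, mul_sub, Finset.sum_sub_distrib]
  congr 1
  · exact Finset.sum_congr rfl fun j _ => by ring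
  · simp only [Finset.mul_sum]
    rw [Finset.sum_comm]
    exact Finset.sum_congr rfl fun j _ => Finset.sum_congr rfl fun k _ => by ring
end

section
/- Let A ∈ ℝ^{n×d}, x ∈ ℝ^d, b ∈ ℝ^n, and define u(x) = exp(Ax) (entrywise), α(x) = ⟨u(x), 1_n⟩, c(x) = u(x) - α(x)·b, and the n×n matrix B(x) = diag(u(x) ∘ u(x)) - (u(x) ∘ b)·u(x)^⊤ - u(x)·(u(x) ∘ b)^⊤ + ‖b‖_2² · u(x)u(x)^⊤ + diag(c(x) ∘ u(x)) - ⟨c(x), b⟩ · diag(u(x)). Let R₀ = max{‖u(x)‖_2, ‖b‖_2, ‖c(x)‖_2, 1}. Then, in the Loewner (positive-semidefinite) order, -10·R₀⁴·I_n ⪯ B(x) ⪯ 10·R₀⁴·I_n. -/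
/-- `B(x) = diag(u∘u) - (u∘b)uᵀ - u(u∘b)ᵀ + ‖b‖₂²·uuᵀ + diag(c∘u) - ⟨c,b⟩·diag(u)`. -/
noncomputable def Bmat {n d : ℕ} (A : Matrix (Fin n) (Fin d) ℝ) (b : Fin n → ℝ)
    (x : Fin d → ℝ) : Matrix (Fin n) (Fin n) ℝ :=
  Matrix.diagonal (fun k => uexp A x k * uexp A x k)
    - Matrix.vecMulVec (fun k => uexp A x k * b k) (uexp A x)
    - Matrix.vecMulVec (uexp A x) (fun k => uexp A x k * b k)
    + norm2 b ^ 2 • Matrix.vecMulVec (uexp A x) (uexp A x)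
    + Matrix.diagonal (fun k => cfun A b x k * uexp A x k)
    - (∑ k, cfun A b x k * b k) • Matrix.diagonal (uexp A x)

open Matrix

lemma sum_sq_le_of_norm2_le {n : ℕ} {v : Fin n → ℝ} {r : ℝ} (h : norm2 v ≤ r) :
    ∑ i, v i ^ 2 ≤ r ^ 2 :=
  (Real.sqrt_le_left ((Real.sqrt_nonneg _).trans h)).mp h

lemma sq_le_of_sum_sq_le {ι : Type*} [Fintype ι] {v : ι → ℝ} {r : ℝ}
    (h : ∑ i, v i ^ 2 ≤ r) (k : ι) : v k ^ 2 ≤ r :=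
  (Finset.single_le_sum (f := fun i => v i ^ 2) (fun i _ => sq_nonneg (v i))
    (Finset.mem_univ k)).trans h

lemma sq_sum_mul_le {ι : Type*} [Fintype ι] {v : ι → ℝ} {r : ℝ}
    (h : ∑ i, v i ^ 2 ≤ r) (y : ι → ℝ) : (∑ i, v i * y i) ^ 2 ≤ r * ∑ i, y i ^ 2 :=
  (Finset.sum_mul_sq_le_sq_mul_sq _ _ _).trans
    (mul_le_mul_of_nonneg_right h (Finset.sum_nonneg fun i _ => sq_nonneg (y i)))

lemma abs_sum_mul_sq_le {ι : Type*} [Fintype ι] {w : ι → ℝ} {r : ℝ}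
    (h : ∀ i, |w i| ≤ r) (y : ι → ℝ) : |∑ i, w i * y i ^ 2| ≤ r * ∑ i, y i ^ 2 := by
  rw [Finset.mul_sum]
  refine (Finset.abs_sum_le_sum_abs _ _).trans (Finset.sum_le_sum fun i _ => ?_)
  rw [abs_mul, abs_of_nonneg (sq_nonneg (y i))]
  exact mul_le_mul_of_nonneg_right (h i) (sq_nonneg _)

lemma Bmat_isHermitian {n d : ℕ} (A : Matrix (Fin n) (Fin d) ℝ) (b : Fin n → ℝ)
    (x : Fin d → ℝ) : (Bmat A b x).IsHermitian := by
  ext i j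
  rcases eq_or_ne i j with rfl | h
  · simp
  · simp [Bmat, vecMulVec_apply, h, h.symm]
    ring

lemma dotProduct_Bmat_mulVec {n d : ℕ} (A : Matrix (Fin n) (Fin d) ℝ) (b : Fin n → ℝ)
    (x : Fin d → ℝ) (y : Fin n → ℝ) :
    y ⬝ᵥ Bmat A b x *ᵥ y =
      ∑ k, uexp A x k * uexp A x k * y k ^ 2
        - 2 * (∑ k, uexp A x k * b k * y k) * ∑ k, uexp A x k * y k
        + norm2 b ^ 2 * (∑ k, uexp A x k * y k) ^ 2
        + ∑ k, cfun A b x k * uexp A x k * y k ^ 2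
        - (∑ k, cfun A b x k * b k) * ∑ k, uexp A x k * y k ^ 2 := by
  have hdiag (w : Fin n → ℝ) : y ⬝ᵥ diagonal w *ᵥ y = ∑ k, w k * y k ^ 2 := by
    simp only [dotProduct, mulVec_diagonal]
    exact Finset.sum_congr rfl fun k _ => by ring
  have hvec (v w : Fin n → ℝ) :
      y ⬝ᵥ vecMulVec v w *ᵥ y = (∑ k, v k * y k) * ∑ k, w k * y k := by
    rw [vecMulVec_mulVec, dotProduct_comm]
    simp [dotProduct, Finset.sum_mul, mul_assoc, mul_comm]
  simp only [Bmat, sub_mulVec, add_mulVec, smul_mulVec, dotProduct_sub, dotProduct_add,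
    dotProduct_smul, hdiag, hvec, smul_eq_mul]
  ring

lemma abs_dotProduct_Bmat_mulVec_le {n d : ℕ} (A : Matrix (Fin n) (Fin d) ℝ) (b : Fin n → ℝ)
    (x : Fin d → ℝ) {R : ℝ} (hR : 1 ≤ R) (hu : norm2 (uexp A x) ≤ R) (hb : norm2 b ≤ R)
    (hc : norm2 (cfun A b x) ≤ R) (y : Fin n → ℝ) :
    |y ⬝ᵥ Bmat A b x *ᵥ y| ≤ 10 * R ^ 4 * ∑ k, y k ^ 2 := by
  have hR0 : 0 ≤ R := zero_le_one.trans hR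
  have hb2 : norm2 b ^ 2 ≤ R ^ 2 := pow_le_pow_left₀ (Real.sqrt_nonneg _) hb 2
  rw [dotProduct_Bmat_mulVec]
  replace hu := sum_sq_le_of_norm2_le hu
  replace hb := sum_sq_le_of_norm2_le hb
  replace hc := sum_sq_le_of_norm2_le hc
  generalize uexp A x = u at *
  generalize cfun A b x = c at *
  have hu' k : |u k| ≤ R := abs_le_of_sq_le_sq (sq_le_of_sum_sq_le hu k) hR0
  have hc' k : |c k| ≤ R := abs_le_of_sq_le_sq (sq_le_of_sum_sq_le hc k) hR0
  have hub : ∑ k, (u k * b k) ^ 2 ≤ R ^ 4 := calc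
    ∑ k, (u k * b k) ^ 2 ≤ ∑ k, R ^ 2 * b k ^ 2 := Finset.sum_le_sum fun k _ => by
        rw [mul_pow]
        exact mul_le_mul_of_nonneg_right (sq_le_of_sum_sq_le hu k) (sq_nonneg _)
    _ = R ^ 2 * ∑ k, b k ^ 2 := (Finset.mul_sum _ _ _).symm
    _ ≤ R ^ 2 * R ^ 2 := mul_le_mul_of_nonneg_left hb (sq_nonneg R)
    _ = R ^ 4 := by ring
  have hcb : |∑ k, c k * b k| ≤ R ^ 2 := by
    refine abs_le_of_sq_le_sq ((sq_sum_mul_le hc b).trans ?_) (sq_nonneg R)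
    rw [sq (R ^ 2)]
    exact mul_le_mul_of_nonneg_left hb (sq_nonneg R)
  have hS : 0 ≤ ∑ k, y k ^ 2 := Finset.sum_nonneg fun k _ => sq_nonneg (y k)
  have h1 := abs_sum_mul_sq_le (w := fun k => u k * u k) (r := R * R) (fun k => by
    rw [abs_mul]; exact mul_le_mul (hu' k) (hu' k) (abs_nonneg _) hR0) y
  have h2 := abs_sum_mul_sq_le (w := fun k => c k * u k) (r := R * R) (fun k => by
    rw [abs_mul]; exact mul_le_mul (hc' k) (hu' k) (abs_nonneg _) hR0) y
  have h3 := abs_sum_mul_sq_le hu' y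
  have hp := sq_sum_mul_le hub y
  have hq := sq_sum_mul_le hu y
  have h4 : |(∑ k, c k * b k) * ∑ k, u k * y k ^ 2| ≤ R ^ 2 * (R * ∑ k, y k ^ 2) := by
    rw [abs_mul]; exact mul_le_mul hcb h3 (abs_nonneg _) (sq_nonneg R)
  have h5 : norm2 b ^ 2 * (∑ k, u k * y k) ^ 2 ≤ R ^ 2 * (R ^ 2 * ∑ k, y k ^ 2) :=
    mul_le_mul hb2 hq (sq_nonneg _) (sq_nonneg R)
  have h6 : 0 ≤ norm2 b ^ 2 * (∑ k, u k * y k) ^ 2 := by positivity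
  generalize ∑ k, y k ^ 2 = S at *
  generalize ∑ k, u k * b k * y k = p at *
  generalize ∑ k, u k * y k = q at *
  have hR2 : R ^ 2 * S ≤ R ^ 4 * S :=
    mul_le_mul_of_nonneg_right (pow_le_pow_right₀ hR (by norm_num)) hS
  have hR3 : R ^ 3 * S ≤ R ^ 4 * S :=
    mul_le_mul_of_nonneg_right (pow_le_pow_right₀ hR (by norm_num)) hS
  have hR4 : 0 ≤ R ^ 4 * S := by positivity
  rw [abs_le] at *
  constructor <;> nlinarith [sq_nonneg (p - q), sq_nonneg (p + q)]

/-- With `R₀ = max{‖u(x)‖₂, ‖b‖₂, ‖c(x)‖₂, 1}`, one has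
`-10·R₀⁴·I_n ⪯ B(x) ⪯ 10·R₀⁴·I_n` in the Loewner order. -/
theorem Bmat_psd_bounds (n d : ℕ) (A : Matrix (Fin n) (Fin d) ℝ) (b : Fin n → ℝ)
    (x : Fin d → ℝ)
    (R₀ : ℝ) (hR₀ : R₀ = max (max (norm2 (uexp A x)) (norm2 b)) (max (norm2 (cfun A b x)) 1)) :
    (Bmat A b x + (10 * R₀ ^ 4) • (1 : Matrix (Fin n) (Fin n) ℝ)).PosSemidef ∧
    ((10 * R₀ ^ 4) • (1 : Matrix (Fin n) (Fin n) ℝ) - Bmat A b x).PosSemidef := by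
  have hu : norm2 (uexp A x) ≤ R₀ := by simp [hR₀]
  have hb : norm2 b ≤ R₀ := by simp [hR₀]
  have hc : norm2 (cfun A b x) ≤ R₀ := by simp [hR₀]
  have hR : 1 ≤ R₀ := by simp [hR₀]
  have hone : ((10 * R₀ ^ 4) • (1 : Matrix (Fin n) (Fin n) ℝ)).IsHermitian :=
    isHermitian_one.smul (IsSelfAdjoint.all _)
  have hB := Bmat_isHermitian A b x
  have hquad (y : Fin n → ℝ) :
      y ⬝ᵥ ((10 * R₀ ^ 4) • (1 : Matrix (Fin n) (Fin n) ℝ)) *ᵥ y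
        = 10 * R₀ ^ 4 * ∑ k, y k ^ 2 := by
    rw [smul_mulVec, one_mulVec, dotProduct_smul, smul_eq_mul]
    simp only [dotProduct, sq]
  have hbound y := abs_le.mp (abs_dotProduct_Bmat_mulVec_le A b x hR hu hb hc y)
  refine ⟨.of_dotProduct_mulVec_nonneg (hB.add hone) fun y => ?_,
    .of_dotProduct_mulVec_nonneg (hone.sub hB) fun y => ?_⟩
  · rw [star_trivial, add_mulVec, dotProduct_add, hquad]
    linarith [(hbound y).1]
  · rw [star_trivial, sub_mulVec, dotProduct_sub, hquad]
    linarith [(hbound y).2]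
end
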